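/- arXiv:2101.10316 — 3 statements merged into one kernel-verified Lean document; each statement's English description precedes it below -/
import Mathlib

section
/- Let f ∈ Thompson's group F. Suppose that f has no proper roots in F (there is no g ∈ F and integer k ≥ 2 with g^k = f) and that f fixes no dyadic rational in the open interval (0,1) (equivalently, the reduced annular strand diagram of f is connected). Then the centralizer of f in F is the cyclic subgroup generated by f: every h ∈ F with hf = fh is an integer power of f. -/
noncomputable section

open Set

noncomputable section

open Set

def x0fun : ℝ → ℝ := fun t =>
  if t < 0 then t
  else if t ≤ 1/2 then t / 2
  else if t ≤ 3/4 then t - 1/4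
  else if t ≤ 1 then 2 * t - 1
  else t

def x0inv : ℝ → ℝ := fun t =>
  if t < 0 then t
  else if t ≤ 1/4 then 2 * t
  else if t ≤ 1/2 then t + 1/4
  else if t ≤ 1 then (t + 1) / 2
  else t

/-- The generator `x₀` of Thompson's group `F`, as a permutation of `ℝ`
(the identity outside `[0,1]`). -/
def x0 : Equiv.Perm ℝ where
  toFun := x0fun
  invFun := x0inv
  left_inv := by
    intro t
    show x0inv (x0fun t) = t
    unfold x0fun
    split_ifs <;> (unfold x0inv; split_ifs <;> linarith)
  right_inv := by
    intro t
    show x0fun (x0inv t) = t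
    unfold x0inv
    split_ifs <;> (unfold x0fun; split_ifs <;> linarith)

def x1fun : ℝ → ℝ := fun t =>
  if t < 0 then t
  else if t ≤ 1/2 then t
  else if t ≤ 3/4 then t / 2 + 1/4
  else if t ≤ 7/8 then t - 1/8
  else if t ≤ 1 then 2 * t - 1
  else t

def x1inv : ℝ → ℝ := fun t =>
  if t < 0 then t
  else if t ≤ 1/2 then t
  else if t ≤ 5/8 then 2 * t - 1/2
  else if t ≤ 3/4 then t + 1/8
  else if t ≤ 1 then (t + 1) / 2
  else t

set_option maxHeartbeats 2000000 in
/-- The generator `x₁` of Thompson's group `F`, as a permutation of `ℝ`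
(the identity outside `[0,1]`). -/
def x1 : Equiv.Perm ℝ where
  toFun := x1fun
  invFun := x1inv
  left_inv := by
    intro t
    show x1inv (x1fun t) = t
    unfold x1fun
    split_ifs <;> (unfold x1inv; split_ifs <;> linarith)
  right_inv := by
    intro t
    show x1fun (x1inv t) = t
    unfold x1inv
    split_ifs <;> (unfold x1fun; split_ifs <;> linarith)

/-- Thompson's group `F`: the subgroup generated by `x₀` and `x₁`. -/
def ThompsonF : Subgroup (Equiv.Perm ℝ) :=
  Subgroup.closure ({x0, x1} : Set (Equiv.Perm ℝ))

/-- Word length with respect to the generating set `{x₀, x₁}`. -/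
def wordLength (f : Equiv.Perm ℝ) : ℕ :=
  sInf {n | ∃ w : List (Equiv.Perm ℝ), w.length = n ∧
    (∀ g ∈ w, g ∈ ({x0, x1, x0⁻¹, x1⁻¹} : Set (Equiv.Perm ℝ))) ∧ w.prod = f}
/-- A dyadic rational `k/2^m`. -/
def IsDyadicRat (q : ℝ) : Prop := ∃ k : ℤ, ∃ m : ℕ, q = (k : ℝ) / 2 ^ m


open Filter Topology

theorem IsDyadicRat.add {p q : ℝ} (hp : IsDyadicRat p) (hq : IsDyadicRat q) :
    IsDyadicRat (p + q) := by
  obtain ⟨k, m, rfl⟩ := hp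
  obtain ⟨l, n, rfl⟩ := hq
  refine ⟨k * 2 ^ n + l * 2 ^ m, m + n, ?_⟩
  push_cast
  rw [pow_add]
  field_simp

theorem IsDyadicRat.div_two {q : ℝ} (hq : IsDyadicRat q) : IsDyadicRat (q / 2) := by
  obtain ⟨k, m, rfl⟩ := hq
  exact ⟨k, m + 1, by rw [pow_succ]; field_simp⟩

theorem IsDyadicRat.two_mul {q : ℝ} (hq : IsDyadicRat q) : IsDyadicRat (2 * q) :=
  _root_.two_mul q ▸ hq.add hq

theorem isDyadicRat_int_div_eight (k : ℤ) : IsDyadicRat (k / 8) :=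
  ⟨k, 3, by norm_num⟩

/-- Adding a multiple of `1/8` preserves dyadic rationals. -/
theorem IsDyadicRat.of_add_eighth {p q : ℝ} (hq : IsDyadicRat q) (k : ℤ) (h : p = q + k / 8) :
    IsDyadicRat p :=
  h ▸ hq.add (isDyadicRat_int_div_eight k)

theorem x0fun_isDyadicRat {q : ℝ} (hq : IsDyadicRat q) : IsDyadicRat (x0fun q) := by
  unfold x0fun
  split_ifs
  · exact hq
  · exact hq.div_two
  · exact hq.of_add_eighth (-2) (by push_cast; ring)
  · exact hq.two_mul.of_add_eighth (-8) (by push_cast; ring)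
  · exact hq

theorem x0inv_isDyadicRat {q : ℝ} (hq : IsDyadicRat q) : IsDyadicRat (x0inv q) := by
  unfold x0inv
  split_ifs
  · exact hq
  · exact hq.two_mul
  · exact hq.of_add_eighth 2 (by push_cast; ring)
  · exact (hq.of_add_eighth 8 (by push_cast; ring)).div_two
  · exact hq

theorem x1fun_isDyadicRat {q : ℝ} (hq : IsDyadicRat q) : IsDyadicRat (x1fun q) := by
  unfold x1fun
  split_ifs
  · exact hq
  · exact hq
  · exact hq.div_two.of_add_eighth 2 (by push_cast; ring)
  · exact hq.of_add_eighth (-1) (by push_cast; ring)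
  · exact hq.two_mul.of_add_eighth (-8) (by push_cast; ring)
  · exact hq

theorem x1inv_isDyadicRat {q : ℝ} (hq : IsDyadicRat q) : IsDyadicRat (x1inv q) := by
  unfold x1inv
  split_ifs
  · exact hq
  · exact hq
  · exact hq.two_mul.of_add_eighth (-4) (by push_cast; ring)
  · exact hq.of_add_eighth 1 (by push_cast; ring)
  · exact (hq.of_add_eighth 8 (by push_cast; ring)).div_two
  · exact hq

/-- `g` is affine and nonconstant in a neighbourhood of `x`. -/
def LocallyAffineAt (g : ℝ → ℝ) (x : ℝ) : Prop :=
  ∃ a : ℝ, a ≠ 0 ∧ ∀ᶠ y in 𝓝 x, g y = g x + a * (y - x)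

theorem LocallyAffineAt.of_eventually {g : ℝ → ℝ} {x a b : ℝ} (ha : a ≠ 0)
    (h : ∀ᶠ y in 𝓝 x, g y = a * y + b) : LocallyAffineAt g x := by
  refine ⟨a, ha, h.mono fun y hy => ?_⟩
  rw [hy, h.self_of_nhds]
  ring

theorem x0fun_locallyAffineAt {x : ℝ} (hx : ¬ IsDyadicRat x) : LocallyAffineAt x0fun x := by
  have key (k : ℤ) : x ≠ k / 8 := fun h => hx (h ▸ isDyadicRat_int_div_eight k)
  have h0 : x ≠ 0 := by simpa using key 0
  have h1 : x ≠ 1 / 2 := fun h => key 4 (by rw [h]; norm_num)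
  have h2 : x ≠ 3 / 4 := fun h => key 6 (by rw [h]; norm_num)
  have h3 : x ≠ 1 := fun h => key 8 (by rw [h]; norm_num)
  rcases h0.lt_or_gt with h0 | h0
  · refine .of_eventually (a := 1) (b := 0) (by norm_num) ?_
    filter_upwards [Iio_mem_nhds h0] with y hy
    simp only [mem_Iio] at hy
    unfold x0fun
    split_ifs <;> linarith
  rcases h1.lt_or_gt with h1 | h1
  · refine .of_eventually (a := 1 / 2) (b := 0) (by norm_num) ?_
    filter_upwards [Ioo_mem_nhds h0 h1] with y ⟨hy, hy'⟩
    unfold x0fun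
    split_ifs <;> linarith
  rcases h2.lt_or_gt with h2 | h2
  · refine .of_eventually (a := 1) (b := -1 / 4) (by norm_num) ?_
    filter_upwards [Ioo_mem_nhds h1 h2] with y ⟨hy, hy'⟩
    unfold x0fun
    split_ifs <;> linarith
  rcases h3.lt_or_gt with h3 | h3
  · refine .of_eventually (a := 2) (b := -1) (by norm_num) ?_
    filter_upwards [Ioo_mem_nhds h2 h3] with y ⟨hy, hy'⟩
    unfold x0fun
    split_ifs <;> linarith
  · refine .of_eventually (a := 1) (b := 0) (by norm_num) ?_
    filter_upwards [Ioi_mem_nhds h3] with y hy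
    simp only [mem_Ioi] at hy
    unfold x0fun
    split_ifs <;> linarith

theorem x1fun_locallyAffineAt {x : ℝ} (hx : ¬ IsDyadicRat x) : LocallyAffineAt x1fun x := by
  have key (k : ℤ) : x ≠ k / 8 := fun h => hx (h ▸ isDyadicRat_int_div_eight k)
  have h1 : x ≠ 1 / 2 := fun h => key 4 (by rw [h]; norm_num)
  have h2 : x ≠ 3 / 4 := fun h => key 6 (by rw [h]; norm_num)
  have h3 : x ≠ 7 / 8 := fun h => key 7 (by rw [h]; norm_num)
  have h4 : x ≠ 1 := fun h => key 8 (by rw [h]; norm_num)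
  rcases h1.lt_or_gt with h1 | h1
  · refine .of_eventually (a := 1) (b := 0) (by norm_num) ?_
    filter_upwards [Iio_mem_nhds h1] with y hy
    simp only [mem_Iio] at hy
    unfold x1fun
    split_ifs <;> linarith
  rcases h2.lt_or_gt with h2 | h2
  · refine .of_eventually (a := 1 / 2) (b := 1 / 4) (by norm_num) ?_
    filter_upwards [Ioo_mem_nhds h1 h2] with y ⟨hy, hy'⟩
    unfold x1fun
    split_ifs <;> linarith
  rcases h3.lt_or_gt with h3 | h3
  · refine .of_eventually (a := 1) (b := -1 / 8) (by norm_num) ?_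
    filter_upwards [Ioo_mem_nhds h2 h3] with y ⟨hy, hy'⟩
    unfold x1fun
    split_ifs <;> linarith
  rcases h4.lt_or_gt with h4 | h4
  · refine .of_eventually (a := 2) (b := -1) (by norm_num) ?_
    filter_upwards [Ioo_mem_nhds h3 h4] with y ⟨hy, hy'⟩
    unfold x1fun
    split_ifs <;> linarith
  · refine .of_eventually (a := 1) (b := 0) (by norm_num) ?_
    filter_upwards [Ioi_mem_nhds h4] with y hy
    simp only [mem_Ioi] at hy
    unfold x1fun
    split_ifs <;> linarith

theorem perm_apply_inv_self {α : Type*} (g : Equiv.Perm α) (x : α) : g (g⁻¹ x) = x :=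
  g.apply_symm_apply x

theorem perm_inv_apply_self {α : Type*} (g : Equiv.Perm α) (x : α) : g⁻¹ (g x) = x :=
  g.symm_apply_apply x

theorem tendsto_nhdsGT_of_strictMono {g : ℝ → ℝ} {x : ℝ} (hg : StrictMono g)
    (hc : Continuous g) (hx : g x = x) : Tendsto g (𝓝[>] x) (𝓝[>] x) := by
  refine tendsto_nhdsWithin_iff.2 ⟨?_, eventually_mem_nhdsWithin.mono fun y hy => ?_⟩
  · simpa only [hx] using (hc.tendsto x).mono_left nhdsWithin_le_nhds
  · simpa only [hx, mem_Ioi] using hg (mem_Ioi.1 hy)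

/-- `g` is multiplication by `2 ^ k` on the right of `0`. -/
def HasInitialSlope (g : Equiv.Perm ℝ) (k : ℤ) : Prop :=
  ∀ᶠ y in 𝓝[>] (0 : ℝ), g y = 2 ^ k * y

theorem hasInitialSlope_one : HasInitialSlope 1 0 :=
  .of_forall fun y => by simp

/-- The properties of elements of Thompson's group used below: piecewise-linear homeomorphisms
supported in `[0,1]`, preserving dyadic rationals, with breakpoints at dyadic rationals only and
with a power of two as initial slope. -/
structure IsDyadicPL (g : Equiv.Perm ℝ) : Prop where
  strictMono : StrictMono g
  apply_of_nonpos : ∀ y ≤ 0, g y = y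
  apply_of_one_le : ∀ y, 1 ≤ y → g y = y
  isDyadicRat_iff : ∀ q, IsDyadicRat (g q) ↔ IsDyadicRat q
  locallyAffineAt : ∀ x, ¬ IsDyadicRat x → LocallyAffineAt g x
  exists_hasInitialSlope : ∃ k, HasInitialSlope g k

namespace IsDyadicPL

variable {g h : Equiv.Perm ℝ}

protected theorem continuous (hg : IsDyadicPL g) : Continuous g :=
  hg.strictMono.monotone.continuous_of_surjective g.surjective

theorem strictMono_inv (hg : IsDyadicPL g) : StrictMono (g⁻¹ : Equiv.Perm ℝ) := by
  intro a b hab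
  rw [← hg.strictMono.lt_iff_lt]
  simpa using hab

theorem inv_apply_of_nonpos (hg : IsDyadicPL g) {y : ℝ} (hy : y ≤ 0) : g⁻¹ y = y := by
  rw [Equiv.Perm.inv_eq_iff_eq, hg.apply_of_nonpos y hy]

theorem inv_apply_of_one_le (hg : IsDyadicPL g) {y : ℝ} (hy : 1 ≤ y) : g⁻¹ y = y := by
  rw [Equiv.Perm.inv_eq_iff_eq, hg.apply_of_one_le y hy]

theorem continuous_inv (hg : IsDyadicPL g) : Continuous (g⁻¹ : Equiv.Perm ℝ) :=
  hg.strictMono_inv.monotone.continuous_of_surjective (g⁻¹ : Equiv.Perm ℝ).surjective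

theorem tendsto_nhdsGT_zero (hg : IsDyadicPL g) : Tendsto g (𝓝[>] 0) (𝓝[>] 0) :=
  tendsto_nhdsGT_of_strictMono hg.strictMono hg.continuous (hg.apply_of_nonpos 0 le_rfl)

theorem hasInitialSlope_mul (hh : IsDyadicPL h) {k l : ℤ}
    (hk : HasInitialSlope g k) (hl : HasInitialSlope h l) : HasInitialSlope (g * h) (k + l) := by
  filter_upwards [hh.tendsto_nhdsGT_zero.eventually hk, hl] with y h1 h2
  rw [Equiv.Perm.mul_apply, h1, h2, zpow_add₀ two_ne_zero, mul_assoc]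

theorem hasInitialSlope_inv (hg : IsDyadicPL g) {k : ℤ} (hk : HasInitialSlope g k) :
    HasInitialSlope g⁻¹ (-k) := by
  have ht := tendsto_nhdsGT_of_strictMono hg.strictMono_inv hg.continuous_inv
    (hg.inv_apply_of_nonpos le_rfl)
  filter_upwards [ht.eventually hk] with y hy
  rw [perm_apply_inv_self] at hy
  rw [zpow_neg, eq_inv_mul_iff_mul_eq₀ (by positivity), ← hy]

protected theorem one : IsDyadicPL 1 where
  strictMono := strictMono_id
  apply_of_nonpos _ _ := rfl
  apply_of_one_le _ _ := rfl
  isDyadicRat_iff _ := Iff.rfl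
  locallyAffineAt x _ := ⟨1, one_ne_zero, .of_forall fun y => by simp⟩
  exists_hasInitialSlope := ⟨0, hasInitialSlope_one⟩

protected theorem mul (hg : IsDyadicPL g) (hh : IsDyadicPL h) : IsDyadicPL (g * h) where
  strictMono := hg.strictMono.comp hh.strictMono
  apply_of_nonpos y hy := by
    rw [Equiv.Perm.mul_apply, hh.apply_of_nonpos y hy, hg.apply_of_nonpos y hy]
  apply_of_one_le y hy := by
    rw [Equiv.Perm.mul_apply, hh.apply_of_one_le y hy, hg.apply_of_one_le y hy]
  isDyadicRat_iff q := (hg.isDyadicRat_iff _).trans (hh.isDyadicRat_iff q)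
  locallyAffineAt x hx := by
    obtain ⟨a, ha, hga⟩ := hg.locallyAffineAt (h x) (by rwa [hh.isDyadicRat_iff])
    obtain ⟨b, hb, hhb⟩ := hh.locallyAffineAt x hx
    refine ⟨a * b, mul_ne_zero ha hb, ?_⟩
    filter_upwards [(hh.continuous.tendsto x).eventually hga, hhb] with y h1 h2
    rw [Equiv.Perm.mul_apply, h1, h2, Equiv.Perm.mul_apply]
    ring
  exists_hasInitialSlope := by
    obtain ⟨k, hk⟩ := hg.exists_hasInitialSlope
    obtain ⟨l, hl⟩ := hh.exists_hasInitialSlope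
    exact ⟨k + l, hh.hasInitialSlope_mul hk hl⟩

protected theorem inv (hg : IsDyadicPL g) : IsDyadicPL g⁻¹ where
  strictMono := hg.strictMono_inv
  apply_of_nonpos _ := hg.inv_apply_of_nonpos
  apply_of_one_le _ := hg.inv_apply_of_one_le
  isDyadicRat_iff q := by rw [← hg.isDyadicRat_iff, perm_apply_inv_self]
  locallyAffineAt x hx := by
    obtain ⟨a, ha, hga⟩ := hg.locallyAffineAt (g⁻¹ x)
      (by rwa [← hg.isDyadicRat_iff, perm_apply_inv_self])
    refine ⟨a⁻¹, inv_ne_zero ha, ?_⟩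
    filter_upwards [(hg.continuous_inv.tendsto x).eventually hga] with y hy
    rw [perm_apply_inv_self, perm_apply_inv_self] at hy
    have : y - x = a * (g⁻¹ y - g⁻¹ x) := by linarith
    rw [this, inv_mul_cancel_left₀ ha]
    ring
  exists_hasInitialSlope :=
    let ⟨k, hk⟩ := hg.exists_hasInitialSlope
    ⟨-k, hg.hasInitialSlope_inv hk⟩

theorem hasInitialSlope_zpow (hg : IsDyadicPL g) {k : ℤ} (hk : HasInitialSlope g k) (m : ℤ) :
    HasInitialSlope (g ^ m) (m * k) := by
  induction m using Int.induction_on with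
  | zero => simpa using hasInitialSlope_one
  | succ n ih =>
    rw [zpow_add_one, add_mul, one_mul]
    exact hg.hasInitialSlope_mul ih hk
  | pred n ih =>
    rw [zpow_sub_one, sub_mul, one_mul, sub_eq_add_neg]
    exact hg.inv.hasInitialSlope_mul ih (hg.hasInitialSlope_inv hk)

protected theorem x0 : IsDyadicPL x0 where
  strictMono := by
    intro a b hab
    change x0fun a < x0fun b
    unfold x0fun
    split_ifs <;> linarith
  apply_of_nonpos y hy := by
    change x0fun y = y
    unfold x0fun
    split_ifs <;> linarith
  apply_of_one_le y hy := by
    change x0fun y = y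
    unfold x0fun
    split_ifs <;> linarith
  isDyadicRat_iff q := by
    refine ⟨fun h => ?_, x0fun_isDyadicRat⟩
    rw [← x0.symm_apply_apply q]
    exact x0inv_isDyadicRat h
  locallyAffineAt _ := x0fun_locallyAffineAt
  exists_hasInitialSlope := by
    refine ⟨-1, ?_⟩
    filter_upwards [Ioo_mem_nhdsGT (show (0 : ℝ) < 1 / 2 by norm_num)] with y ⟨hy, hy'⟩
    change x0fun y = _
    rw [zpow_neg_one]
    unfold x0fun
    split_ifs <;> linarith

protected theorem x1 : IsDyadicPL x1 where
  strictMono := by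
    intro a b hab
    change x1fun a < x1fun b
    unfold x1fun
    split_ifs <;> linarith
  apply_of_nonpos y hy := by
    change x1fun y = y
    unfold x1fun
    split_ifs <;> linarith
  apply_of_one_le y hy := by
    change x1fun y = y
    unfold x1fun
    split_ifs <;> linarith
  isDyadicRat_iff q := by
    refine ⟨fun h => ?_, x1fun_isDyadicRat⟩
    rw [← x1.symm_apply_apply q]
    exact x1inv_isDyadicRat h
  locallyAffineAt _ := x1fun_locallyAffineAt
  exists_hasInitialSlope := by
    refine ⟨0, ?_⟩
    filter_upwards [Ioo_mem_nhdsGT (show (0 : ℝ) < 1 / 2 by norm_num)] with y ⟨hy, hy'⟩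
    change x1fun y = _
    rw [zpow_zero]
    unfold x1fun
    split_ifs <;> linarith

theorem of_mem_thompsonF (hg : g ∈ ThompsonF) : IsDyadicPL g := by
  induction hg using Subgroup.closure_induction with
  | mem x hx =>
    rcases hx with rfl | rfl
    · exact .x0
    · exact .x1
  | one => exact .one
  | mul _ _ _ _ hx hy => exact hx.mul hy
  | inv _ _ hx => exact hx.inv

/-- If `h` commutes with `f` and is the identity on `(-∞, s]`, it is the identity on
`(-∞, f s]`. -/
theorem eq_self_of_le_apply {f : Equiv.Perm ℝ} (hf : IsDyadicPL f) (hcomm : Commute h f) {s : ℝ}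
    (hs : ∀ y ≤ s, h y = y) {y : ℝ} (hy : y ≤ f s) : h y = y := by
  have hle : f⁻¹ y ≤ s := by
    rw [← hf.strictMono.le_iff_le, perm_apply_inv_self]
    exact hy
  have := DFunLike.congr_fun hcomm.eq (f⁻¹ y)
  simpa only [Equiv.Perm.mul_apply, perm_apply_inv_self, hs _ hle] using this

/-- If `f` has no dyadic fixed point in `(0,1)`, the only element commuting with `f` that is the
identity near `0` is the identity. -/
theorem eq_one_of_commute {f : Equiv.Perm ℝ} (hf : IsDyadicPL f) (hh : IsDyadicPL h)
    (hfix : ∀ q ∈ Ioo (0 : ℝ) 1, IsDyadicRat q → f q ≠ q) (hcomm : Commute h f)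
    (hslope : HasInitialSlope h 0) : h = 1 := by
  let S : Set ℝ := {s | ∀ y ≤ s, h y = y}
  by_contra hne
  have hbound : ∀ s ∈ S, s < 1 := by
    intro s hs
    by_contra! hs1
    refine hne (Equiv.ext fun y => ?_)
    rcases le_total y s with hy | hy
    · exact hs y hy
    · exact hh.apply_of_one_le y (hs1.trans hy)
  have hbdd : BddAbove S := ⟨1, fun s hs => (hbound s hs).le⟩
  obtain ⟨ε, hε, hεS⟩ : ∃ ε > 0, ε ∈ S := by
    obtain ⟨u, hu, hsub⟩ := mem_nhdsGT_iff_exists_Ioc_subset.1 hslope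
    refine ⟨u, hu, fun y hy => ?_⟩
    rcases le_or_gt y 0 with h0 | h0
    · exact hh.apply_of_nonpos y h0
    · simpa using hsub ⟨h0, hy⟩
  set s := sSup S with hs_def
  have hs0 : 0 < s := hε.trans_le (le_csSup hbdd hεS)
  have hlt : ∀ y < s, h y = y := fun y hy => by
    obtain ⟨t, ht, hyt⟩ := exists_lt_of_lt_csSup ⟨ε, hεS⟩ hy
    exact ht y hyt.le
  have hs : h s = s := by
    have h1 : Tendsto h (𝓝[<] s) (𝓝 (h s)) :=
      (hh.continuous.tendsto s).mono_left nhdsWithin_le_nhds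
    have h2 : Tendsto h (𝓝[<] s) (𝓝 s) :=
      (tendsto_id.mono_left nhdsWithin_le_nhds).congr'
        (eventually_mem_nhdsWithin.mono fun y hy => (hlt y hy).symm)
    exact tendsto_nhds_unique h1 h2
  have hsS : s ∈ S := fun y hy => hy.lt_or_eq.elim (hlt y) fun h => h ▸ hs
  have hs1 : s < 1 := hbound s hsS
  rcases lt_trichotomy (f s) s with hfs | hfs | hfs
  · have hmem : f⁻¹ s ∈ S := fun y => hf.inv.eq_self_of_le_apply hcomm.inv_right hsS
    have := hf.strictMono_inv hfs
    rw [perm_inv_apply_self] at this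
    exact this.not_ge (le_csSup hbdd hmem)
  · obtain ⟨a, -, ha⟩ := hh.locallyAffineAt s fun hd => hfix s ⟨hs0, hs1⟩ hd hfs
    obtain ⟨l, u, ⟨hl, hu⟩, hsub⟩ := mem_nhds_iff_exists_Ioo_subset.1 ha
    have ha1 : a = 1 := by
      obtain ⟨y, hly, hys⟩ := exists_between hl
      have hy : h y = h s + a * (y - s) := hsub ⟨hly, hys.trans hu⟩
      rw [hlt y hys, hs] at hy
      have : y - s ≠ 0 := sub_ne_zero.2 hys.ne
      exact mul_right_cancel₀ this (by linarith)
    obtain ⟨t, hst, htu⟩ := exists_between hu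
    have hmem : t ∈ S := fun y hy => by
      rcases le_or_gt y s with hys | hys
      · exact hsS y hys
      · have : h y = h s + a * (y - s) := hsub ⟨hl.trans hys, hy.trans_lt htu⟩
        rw [this, ha1, hs]
        ring
    exact hst.not_ge (le_csSup hbdd hmem)
  · have hmem : f s ∈ S := fun y => hf.eq_self_of_le_apply hcomm hsS
    exact hfs.not_ge (le_csSup hbdd hmem)

end IsDyadicPL

/-- The initial slope exponents of the elements of Thompson's group commuting with `f`. -/
def centralizerSlopes (f : Equiv.Perm ℝ) : AddSubgroup ℤ where
  carrier := {k | ∃ h ∈ ThompsonF, Commute h f ∧ HasInitialSlope h k}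
  zero_mem' := ⟨1, one_mem _, .one_left f, hasInitialSlope_one⟩
  add_mem' := by
    rintro k l ⟨g, hg, hgf, hk⟩ ⟨h, hh, hhf, hl⟩
    exact ⟨g * h, mul_mem hg hh, hgf.mul_left hhf,
      (IsDyadicPL.of_mem_thompsonF hh).hasInitialSlope_mul hk hl⟩
  neg_mem' := by
    rintro k ⟨g, hg, hgf, hk⟩
    exact ⟨g⁻¹, inv_mem hg, hgf.inv_left,
      (IsDyadicPL.of_mem_thompsonF hg).hasInitialSlope_inv hk⟩

/-- If `f` has no dyadic fixed point in `(0,1)`, its centralizer in Thompson's group is cyclic. -/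
theorem exists_generator_centralizer {f : Equiv.Perm ℝ} (hf : f ∈ ThompsonF)
    (hfix : ∀ q ∈ Ioo (0 : ℝ) 1, IsDyadicRat q → f q ≠ q) :
    ∃ g ∈ ThompsonF, ∀ h ∈ ThompsonF, Commute h f → ∃ m : ℤ, h = g ^ m := by
  obtain ⟨n, hn⟩ := Int.subgroup_cyclic (centralizerSlopes f)
  obtain ⟨g, hg, hgf, hgn⟩ : n ∈ centralizerSlopes f :=
    hn ▸ AddSubgroup.subset_closure (mem_singleton n)
  refine ⟨g, hg, fun h hh hhf => ?_⟩
  obtain ⟨k, hk⟩ := (IsDyadicPL.of_mem_thompsonF hh).exists_hasInitialSlope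
  have hkn : k ∈ centralizerSlopes f := ⟨h, hh, hhf, hk⟩
  rw [hn, AddSubgroup.mem_closure_singleton] at hkn
  obtain ⟨m, rfl⟩ := hkn
  have hgm := (IsDyadicPL.of_mem_thompsonF hg).hasInitialSlope_zpow hgn (-m)
  have hslope := (IsDyadicPL.of_mem_thompsonF hh).hasInitialSlope_mul hgm hk
  rw [smul_eq_mul, neg_mul, neg_add_cancel] at hslope
  have hone := (IsDyadicPL.of_mem_thompsonF hf).eq_one_of_commute
    (IsDyadicPL.of_mem_thompsonF (mul_mem (zpow_mem hg (-m)) hh)) hfix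
    ((hgf.zpow_left (-m)).mul_left hhf) hslope
  refine ⟨m, ?_⟩
  rwa [zpow_neg, inv_mul_eq_one, eq_comm] at hone

theorem centralizer_cyclic_of_no_roots_connected (f : Equiv.Perm ℝ) (hf : f ∈ ThompsonF)
    (hroot : ¬ ∃ g ∈ ThompsonF, ∃ k : ℕ, 2 ≤ k ∧ g ^ k = f)
    (hfix : ∀ q ∈ Set.Ioo (0:ℝ) 1, IsDyadicRat q → f q ≠ q) :
    ∀ h ∈ ThompsonF, h * f = f * h → ∃ m : ℤ, h = f ^ m := by
  intro h hh hcomm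
  obtain ⟨g, hg, hgen⟩ := exists_generator_centralizer hf hfix
  obtain ⟨k, hk⟩ := hgen f hf (Commute.refl f)
  obtain ⟨m, hm⟩ := hgen h hh hcomm
  have hk0 : k ≠ 0 := by
    rintro rfl
    exact hfix (1 / 2) (by norm_num) ⟨1, 1, by norm_num⟩ (by rw [hk]; simp)
  have hk1 : k.natAbs = 1 := by
    by_contra hne
    have h2 : 2 ≤ k.natAbs := by omega
    rcases Int.natAbs_eq k with hk' | hk'
    · exact hroot ⟨g, hg, k.natAbs, h2, by rw [hk, ← zpow_natCast, ← hk']⟩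
    · refine hroot ⟨g⁻¹, inv_mem hg, k.natAbs, h2, ?_⟩
      rw [hk, ← zpow_natCast, inv_zpow', ← hk']
  rcases Int.natAbs_eq k with hk' | hk' <;> rw [hk1] at hk'
  · exact ⟨m, by rw [hm, hk, hk']; simp⟩
  · exact ⟨-m, by rw [hm, hk, hk']; simp⟩

end
end
end

section
/- Let f ∈ Thompson's group F and suppose f fixes no dyadic rational in the open interval (0,1) (equivalently, the reduced annular strand diagram of f is connected). Then the centralizer in Thompson's group V of the restriction of f to [0,1) equals the image under restriction of the centralizer of f in F; that is, every k ∈ V commuting with f|_{[0,1)} is strictly increasing on [0,1) and is the restriction of an element of F. -/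
noncomputable section

open Set

noncomputable section

open Set

/-- `a` and `b` are the endpoints of a standard dyadic interval `[k/2^m, (k+1)/2^m]`. -/
def IsStdDyadicPair (a b : ℝ) : Prop :=
  ∃ k m : ℕ, a = (k : ℝ) / 2 ^ m ∧ b = ((k : ℝ) + 1) / 2 ^ m

/-- Membership in Thompson's group `V`, realized as permutations of `ℝ` that are the
identity outside `[0,1)`: there are partitions of `[0,1)` into standard dyadic intervals
`[a_{i−1}, a_i)` and `[b_{i−1}, b_i)` and a permutation `σ` such that `v` maps
`[a_{i−1}, a_i)` onto `[b_{σ(i)−1}, b_{σ(i)})` by an increasing affine map. -/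
def MemV (v : Equiv.Perm ℝ) : Prop :=
  (∀ t, t ∉ Set.Ico (0:ℝ) 1 → v t = t) ∧
  ∃ N : ℕ, ∃ a b : Fin (N + 1) → ℝ, ∃ σ : Equiv.Perm (Fin N),
    a 0 = 0 ∧ a (Fin.last N) = 1 ∧ b 0 = 0 ∧ b (Fin.last N) = 1 ∧
    StrictMono a ∧ StrictMono b ∧
    ∀ i : Fin N, IsStdDyadicPair (a i.castSucc) (a i.succ) ∧
      IsStdDyadicPair (b i.castSucc) (b i.succ) ∧
      ∃ c d : ℝ, 0 < c ∧
        (∀ t ∈ Set.Ico (a i.castSucc) (a i.succ), v t = c * t + d) ∧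
        c * a i.castSucc + d = b (σ i).castSucc ∧ c * a i.succ + d = b (σ i).succ

/-- Word length with respect to a set `S` (products of elements of `S ∪ S⁻¹`). -/
def wordLengthWith (S : Set (Equiv.Perm ℝ)) (v : Equiv.Perm ℝ) : ℕ :=
  sInf {n | ∃ w : List (Equiv.Perm ℝ), w.length = n ∧
    (∀ g ∈ w, g ∈ S ∨ g⁻¹ ∈ S) ∧ w.prod = v}

/-- The points `a 0, …, a N` cut `[0,1]` into `N` standard dyadic intervals. -/
structure IsDyadicSubdivision (N : ℕ) (a : ℕ → ℝ) : Prop where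
  zero : a 0 = 0
  last : a N = 1
  pair : ∀ i < N, IsStdDyadicPair (a i) (a (i + 1))

/-- `g` maps `[a i, a (i+1))` to `[b i, b (i+1))` affinely for every `i < N`. -/
def CarriesAffinely (N : ℕ) (a b : ℕ → ℝ) (g : Equiv.Perm ℝ) : Prop :=
  ∀ i < N, ∀ s ∈ Ico (0:ℝ) 1, g (a i + s * (a (i + 1) - a i)) = b i + s * (b (i + 1) - b i)

/-- The subdivision `0 < 1/2 < 3/4 < ⋯ < 1 - 1/2^(N-1) < 1`. -/
def rightVine (N i : ℕ) : ℝ := if i < N then 1 - (1 / 2) ^ i else 1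

/-- The affine permutation `t ↦ (t + 1) / 2`, which maps `[0,1]` onto `[1/2,1]`. -/
def toRightHalf : Equiv.Perm ℝ where
  toFun t := (t + 1) / 2
  invFun t := 2 * t - 1
  left_inv t := by ring
  right_inv t := by ring

section StandardDyadicIntervals

variable {x y : ℝ}

lemma IsStdDyadicPair.lt (h : IsStdDyadicPair x y) : x < y := by
  obtain ⟨k, m, rfl, rfl⟩ := h
  gcongr
  linarith

lemma IsStdDyadicPair.nonneg (h : IsStdDyadicPair x y) : 0 ≤ x := by
  obtain ⟨k, m, rfl, rfl⟩ := h
  positivity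

lemma IsStdDyadicPair.isDyadicRat (h : IsStdDyadicPair x y) : IsDyadicRat x := by
  obtain ⟨k, m, rfl, rfl⟩ := h
  exact ⟨k, m, by simp⟩

lemma IsStdDyadicPair.eq_inv_two_pow (h : IsStdDyadicPair 0 y) : ∃ m : ℕ, y = 1 / 2 ^ m := by
  obtain ⟨k, m, hk, rfl⟩ := h
  have : (k : ℝ) = 0 := by
    have h2 : (2 : ℝ) ^ m ≠ 0 := by positivity
    field_simp at hk
    linarith
  exact ⟨m, by simp [this]⟩

/-- A standard dyadic interval other than `[0,1]` and `[0,1/2]` lies in one of the pieces on which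
`x₀⁻¹` is affine. -/
lemma IsStdDyadicPair.trichotomy (h : IsStdDyadicPair x y) (hy : y ≤ 1) (h0 : x = 0 → y ≤ 1 / 4) :
    y ≤ 1 / 4 ∨ (1 / 4 ≤ x ∧ y ≤ 1 / 2) ∨ 1 / 2 ≤ x := by
  obtain ⟨k, m, rfl, rfl⟩ := h
  rcases m with _ | _ | m
  · rcases k with _ | k
    · norm_num at h0
    · push_cast at hy ⊢
      have : (0 : ℝ) ≤ k := k.cast_nonneg
      right; right; norm_num; linarith
  · rcases k with _ | k
    · norm_num at h0
    · push_cast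
      have : (0 : ℝ) ≤ k := k.cast_nonneg
      right; right; norm_num; linarith
  · have h2 : (0 : ℝ) < 2 ^ m := by positivity
    simp only [pow_succ]
    rcases lt_or_ge k (2 ^ m) with h | h
    · left
      have : (k : ℝ) + 1 ≤ 2 ^ m := by exact_mod_cast h
      rw [div_le_iff₀ (by positivity)]; linarith
    · have h' : (2 : ℝ) ^ m ≤ k := by exact_mod_cast h
      rcases lt_or_ge k (2 * 2 ^ m) with h3 | h3
      · right; left
        have : (k : ℝ) + 1 ≤ 2 * 2 ^ m := by exact_mod_cast h3
        constructor
        · rw [le_div_iff₀ (by positivity)]; linarith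
        · rw [div_le_iff₀ (by positivity)]; linarith
      · right; right
        have : (2 : ℝ) * 2 ^ m ≤ k := by exact_mod_cast h3
        rw [le_div_iff₀ (by positivity)]; linarith

lemma IsStdDyadicPair.two_mul (h : IsStdDyadicPair x y) (hy : y ≤ 1 / 4) :
    IsStdDyadicPair (2 * x) (2 * y) := by
  obtain ⟨k, m, rfl, rfl⟩ := h
  rcases m with _ | m
  · have : (0 : ℝ) ≤ k := k.cast_nonneg
    norm_num at hy; linarith
  · exact ⟨k, m, by rw [pow_succ]; field_simp, by rw [pow_succ]; field_simp⟩

lemma IsStdDyadicPair.add_quarter (h : IsStdDyadicPair x y) (hx : 1 / 4 ≤ x) (hy : y ≤ 1 / 2) :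
    IsStdDyadicPair (x + 1 / 4) (y + 1 / 4) := by
  obtain ⟨k, m, rfl, rfl⟩ := h
  have : (0 : ℝ) ≤ k := k.cast_nonneg
  rcases m with _ | _ | m
  · norm_num at hy; linarith
  · norm_num at hy hx; linarith
  · refine ⟨k + 2 ^ m, m + 2, ?_, ?_⟩ <;> push_cast <;> field_simp <;> ring

lemma IsStdDyadicPair.right_half (h : IsStdDyadicPair x y) :
    IsStdDyadicPair ((x + 1) / 2) ((y + 1) / 2) := by
  obtain ⟨k, m, rfl, rfl⟩ := h
  refine ⟨k + 2 ^ m, m + 1, ?_, ?_⟩ <;> push_cast <;> field_simp <;> ring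

lemma IsStdDyadicPair.of_right_half (h : IsStdDyadicPair x y) (hx : 1 / 2 ≤ x) (hy : y ≤ 1) :
    IsStdDyadicPair (2 * x - 1) (2 * y - 1) := by
  obtain ⟨k, m, rfl, rfl⟩ := h
  rcases m with _ | m
  · rw [pow_zero, div_one] at hx hy
    have : (1 : ℝ) ≤ k := by
      exact_mod_cast Nat.one_le_iff_ne_zero.2 (by rintro rfl; norm_num at hx)
    linarith
  · have hk : 2 ^ m ≤ k := by
      rw [le_div_iff₀ (by positivity), pow_succ] at hx
      exact_mod_cast (by linarith : (2 : ℝ) ^ m ≤ k)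
    refine ⟨k - 2 ^ m, m, ?_, ?_⟩ <;> push_cast [Nat.cast_sub hk] <;> field_simp <;> ring

end StandardDyadicIntervals

section Subdivisions

variable {N : ℕ} {a : ℕ → ℝ}

lemma IsDyadicSubdivision.le (h : IsDyadicSubdivision N a) {i j : ℕ} (hij : i ≤ j) (hj : j ≤ N) :
    a i ≤ a j := by
  induction j, hij using Nat.le_induction with
  | base => exact le_rfl
  | succ j _ ih => exact (ih (by omega)).trans (h.pair j (by omega)).lt.le

lemma IsDyadicSubdivision.le_one (h : IsDyadicSubdivision N a) {i : ℕ} (hi : i ≤ N) : a i ≤ 1 :=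
  h.last ▸ h.le hi le_rfl

lemma IsDyadicSubdivision.pos (h : IsDyadicSubdivision N a) : 0 < N := by
  rcases Nat.eq_zero_or_pos N with rfl | hN
  · have := h.zero.symm.trans h.last
    norm_num at this
  · exact hN

lemma IsDyadicSubdivision.exists_mem_Ico (h : IsDyadicSubdivision N a) {t : ℝ}
    (ht : t ∈ Ico (0:ℝ) 1) : ∃ i < N, t ∈ Ico (a i) (a (i + 1)) := by
  have key : ∀ n ≤ N, t < a n → ∃ i < n, t ∈ Ico (a i) (a (i + 1)) := by
    intro n
    induction n with
    | zero => intro _ h0; rw [h.zero] at h0; exact absurd ht.1 (not_le.2 h0)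
    | succ n ih =>
      intro hn hlt
      rcases lt_or_ge t (a n) with h1 | h1
      · obtain ⟨i, hi, hm⟩ := ih (by omega) h1
        exact ⟨i, by omega, hm⟩
      · exact ⟨n, by omega, h1, hlt⟩
  exact key N le_rfl (h.last ▸ ht.2)

/-- A subdivision whose first interval is shorter than `[0,1/2]` is carried to a subdivision by
`x₀⁻¹`. -/
lemma IsDyadicSubdivision.x0inv_carries (h : IsDyadicSubdivision N a) (h1 : a 1 ≤ 1 / 4) :
    IsDyadicSubdivision N (fun i => x0inv (a i)) ∧
      CarriesAffinely N a (fun i => x0inv (a i)) x0⁻¹ := by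
  have inv_left : ∀ t, 0 ≤ t → t ≤ 1 / 4 → x0inv t = 2 * t := fun t _ _ => by
    unfold x0inv; split_ifs <;> linarith
  have inv_mid : ∀ t, 1 / 4 ≤ t → t ≤ 1 / 2 → x0inv t = t + 1 / 4 := fun t _ _ => by
    unfold x0inv; split_ifs <;> linarith
  have inv_right : ∀ t, 1 / 2 ≤ t → t ≤ 1 → x0inv t = (t + 1) / 2 := fun t _ _ => by
    unfold x0inv; split_ifs <;> linarith
  have tri : ∀ i < N, a (i + 1) ≤ 1 / 4 ∨ (1 / 4 ≤ a i ∧ a (i + 1) ≤ 1 / 2) ∨ 1 / 2 ≤ a i := by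
    intro i hi
    refine (h.pair i hi).trichotomy (h.le_one hi) fun h0 => ?_
    rcases i with _ | i
    · exact h1
    · have := h.le (i := 1) (j := i + 1) (by omega) hi.le
      have := (h.pair 0 (by omega)).lt
      rw [h.zero, zero_add] at this
      linarith
  refine ⟨⟨?_, ?_, fun i hi => ?_⟩, fun i hi s hs => ?_⟩
  · simp [h.zero, inv_left]
  · simp only [h.last]
    rw [inv_right 1 (by norm_num) le_rfl]; norm_num
  · have hp := h.pair i hi
    have hlt := hp.lt
    have h0 := hp.nonneg
    have hle := h.le_one (i := i + 1) hi
    rcases tri i hi with h2 | ⟨h2, h3⟩ | h2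
    · simp only [inv_left (a i) h0 (by linarith), inv_left (a (i + 1)) (by linarith) h2]
      exact hp.two_mul h2
    · simp only [inv_mid (a i) h2 (by linarith), inv_mid (a (i + 1)) (by linarith) h3]
      exact hp.add_quarter h2 h3
    · simp only [inv_right (a i) h2 (by linarith), inv_right (a (i + 1)) (by linarith) hle]
      exact hp.right_half
  · have hp := h.pair i hi
    have hlt := hp.lt
    have h0 := hp.nonneg
    have hle := h.le_one (i := i + 1) hi
    change x0inv _ = x0inv _ + s * (x0inv _ - x0inv _)
    have hl : a i ≤ a i + s * (a (i + 1) - a i) := by nlinarith [hs.1]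
    have hr : a i + s * (a (i + 1) - a i) ≤ a (i + 1) := by nlinarith [hs.2]
    rcases tri i hi with h2 | ⟨h2, h3⟩ | h2
    · rw [inv_left (a i) h0 (by linarith), inv_left (a (i + 1)) (by linarith) h2,
        inv_left _ (by linarith) (by linarith)]
      ring
    · rw [inv_mid (a i) h2 (by linarith), inv_mid (a (i + 1)) (by linarith) h3,
        inv_mid _ (by linarith) (by linarith)]
      ring
    · rw [inv_right (a i) h2 (by linarith), inv_right (a (i + 1)) (by linarith) hle,
        inv_right _ (by linarith) (by linarith)]
      ring

lemma IsDyadicSubdivision.tail (h : IsDyadicSubdivision (N + 1) a) (h1 : a 1 = 1 / 2) :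
    IsDyadicSubdivision N (fun i => 2 * a (i + 1) - 1) where
  zero := by simp [h1]
  last := by simp only [h.last]; norm_num
  pair i hi := (h.pair (i + 1) (by omega)).of_right_half
    (h1 ▸ h.le (by omega) (by omega)) (h.le_one (by omega))

end Subdivisions

section Generators

lemma toRightHalf_conj_x0 : toRightHalf * x0 * toRightHalf⁻¹ = x1 := by
  ext t
  change (x0fun (2 * t - 1) + 1) / 2 = x1fun t
  unfold x0fun x1fun
  split_ifs <;> linarith

lemma toRightHalf_conj_x1 : toRightHalf * x1 * toRightHalf⁻¹ = x0⁻¹ * x1 * x0 := by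
  suffices x0 * (toRightHalf * x1 * toRightHalf⁻¹) = x1 * x0 by
    rw [mul_assoc x0⁻¹, ← this, inv_mul_cancel_left]
  ext t
  change x0fun ((x1fun (2 * t - 1) + 1) / 2) = x1fun (x0fun t)
  rcases le_or_gt t (3 / 4) with h | h
  · have : x1fun (2 * t - 1) = 2 * t - 1 := by unfold x1fun; split_ifs <;> linarith
    rw [this, show (2 * t - 1 + 1) / 2 = t by ring]
    have : x0fun t ≤ 1 / 2 := by unfold x0fun; split_ifs <;> linarith
    unfold x1fun; split_ifs <;> linarith
  · rcases le_or_gt t 1 with h1 | h1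
    · have h2 : x0fun t = 2 * t - 1 := by unfold x0fun; split_ifs <;> linarith
      have h3 : 1 / 2 ≤ x1fun (2 * t - 1) := by unfold x1fun; split_ifs <;> linarith
      have h4 : x1fun (2 * t - 1) ≤ 1 := by unfold x1fun; split_ifs <;> linarith
      rw [h2]
      unfold x0fun
      split_ifs <;> linarith
    · have h2 : x0fun t = t := by unfold x0fun; split_ifs <;> linarith
      have h3 : x1fun (2 * t - 1) = 2 * t - 1 := by unfold x1fun; split_ifs <;> linarith
      rw [h3, show (2 * t - 1 + 1) / 2 = t by ring, h2]
      unfold x1fun; split_ifs <;> linarith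

lemma x0_mem : x0 ∈ ThompsonF := Subgroup.subset_closure (by simp)

lemma x1_mem : x1 ∈ ThompsonF := Subgroup.subset_closure (by simp)

/-- Conjugating into the right half of the interval preserves `F`. -/
lemma toRightHalf_conj_mem {g : Equiv.Perm ℝ} (hg : g ∈ ThompsonF) :
    toRightHalf * g * toRightHalf⁻¹ ∈ ThompsonF := by
  suffices ThompsonF ≤ ThompsonF.comap (MulAut.conj toRightHalf).toMonoidHom from this hg
  refine (Subgroup.closure_le _).2 ?_
  rintro g (rfl | rfl)
  · change toRightHalf * x0 * toRightHalf⁻¹ ∈ ThompsonF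
    rw [toRightHalf_conj_x0]
    exact x1_mem
  · change toRightHalf * x1 * toRightHalf⁻¹ ∈ ThompsonF
    rw [toRightHalf_conj_x1]
    exact mul_mem (mul_mem (inv_mem x0_mem) x1_mem) x0_mem

lemma ThompsonF.apply_eq_self {g : Equiv.Perm ℝ} (hg : g ∈ ThompsonF) :
    ∀ t ∉ Ico (0:ℝ) 1, g t = t := by
  induction hg using Subgroup.closure_induction with
  | mem g hg =>
    intro t ht
    have ht' : t < 0 ∨ 1 ≤ t := by
      by_contra! h; exact ht h
    rcases hg with rfl | rfl
    · change x0fun t = t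
      unfold x0fun
      rcases ht' with h | h <;> split_ifs <;> linarith
    · change x1fun t = t
      unfold x1fun
      rcases ht' with h | h <;> split_ifs <;> linarith
  | one => simp
  | mul g h _ _ hg hh => intro t ht; rw [Equiv.Perm.mul_apply, hh t ht, hg t ht]
  | inv g _ hg => intro t ht; rw [Equiv.Perm.inv_eq_iff_eq, hg t ht]

lemma ThompsonF.strictMono {g : Equiv.Perm ℝ} (hg : g ∈ ThompsonF) : StrictMono g := by
  induction hg using Subgroup.closure_induction with
  | mem g hg =>
    intro s t hst
    rcases hg with rfl | rfl
    · change x0fun s < x0fun t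
      unfold x0fun
      split_ifs <;> linarith
    · change x1fun s < x1fun t
      unfold x1fun
      split_ifs <;> linarith
  | one => exact strictMono_id
  | mul g h _ _ hg hh => exact hg.comp hh
  | inv g _ hg => intro s t hst; rw [← hg.lt_iff_lt]; simpa using hst

lemma ThompsonF.continuous {g : Equiv.Perm ℝ} (hg : g ∈ ThompsonF) : Continuous g :=
  (ThompsonF.strictMono hg).monotone.continuous_of_surjective g.surjective

/-- Every dyadic subdivision is carried to the right vine with the same number of intervals by an
element of `F`. -/
lemma exists_carriesAffinely_rightVine (N : ℕ) : ∀ a : ℕ → ℝ, IsDyadicSubdivision N a →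
    ∃ g ∈ ThompsonF, CarriesAffinely N a (rightVine N) g := by
  induction N with
  | zero => exact fun a h => absurd h.pos (lt_irrefl 0)
  | succ N ihN =>
    suffices ∀ (m : ℕ) (a : ℕ → ℝ), IsDyadicSubdivision (N + 1) a → a 1 = 1 / 2 ^ m →
        ∃ g ∈ ThompsonF, CarriesAffinely (N + 1) a (rightVine (N + 1)) g by
      intro a h
      have hp := h.pair 0 h.pos
      rw [h.zero] at hp
      obtain ⟨m, hm⟩ := hp.eq_inv_two_pow
      exact this m a h hm
    intro m
    induction m with
    | zero =>
      intro a h h1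
      refine ⟨1, one_mem _, fun i hi s _ => ?_⟩
      rcases N with _ | N
      · obtain rfl : i = 0 := by omega
        simp [h.zero, h1, rightVine]
      · have := (h.pair 1 (by omega)).lt
        have := h.le_one (i := 2) (by omega)
        norm_num at *
        linarith
    | succ m ihm =>
      intro a h h1
      rcases m with _ | m
      · rw [zero_add, pow_one] at h1
        obtain ⟨g, hg, hgc⟩ := ihN _ (h.tail h1)
        have hN := (h.tail h1).pos
        have hvine : ∀ i, rightVine (N + 1) (i + 1) = (rightVine N i + 1) / 2 := by
          intro i
          simp only [rightVine, add_lt_add_iff_right, pow_succ]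
          split_ifs <;> ring
        refine ⟨_, toRightHalf_conj_mem hg, fun i hi s hs => ?_⟩
        change (g (2 * (a i + s * (a (i + 1) - a i)) - 1) + 1) / 2 = _
        rcases i with _ | i
        · rw [ThompsonF.apply_eq_self hg]
          · simp only [h.zero, h1, rightVine, hN, zero_add, Nat.succ_pos, pow_zero,
              if_true, pow_one, Nat.lt_add_left_iff_pos]
            ring
          · simp only [h.zero, h1, zero_add, mem_Ico, not_and, not_lt]
            intro; linarith [hs.2]
        · have := hgc i (by omega) s hs
          rw [hvine, hvine, show 2 * (a (i + 1) + s * (a (i + 1 + 1) - a (i + 1))) - 1 =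
            2 * a (i + 1) - 1 + s * (2 * a (i + 1 + 1) - 1 - (2 * a (i + 1) - 1)) by ring, this]
          ring
      · have hq : a 1 ≤ 1 / 4 := by
          rw [h1, pow_succ, pow_succ, div_le_iff₀ (by positivity)]
          linarith [one_le_pow₀ (one_le_two (α := ℝ)) (n := m)]
        obtain ⟨hsub, hc⟩ := h.x0inv_carries hq
        have hx : x0inv (a 1) = 1 / 2 ^ (m + 1) := by
          have : x0inv (a 1) = 2 * a 1 := by
            have : 0 ≤ a 1 := h1 ▸ by positivity
            unfold x0inv; split_ifs <;> linarith
          rw [this, h1, pow_succ _ (m + 1)]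
          field_simp
        obtain ⟨g, hg, hgc⟩ := ihm _ hsub hx
        refine ⟨g * x0⁻¹, mul_mem hg (inv_mem x0_mem), fun i hi s hs => ?_⟩
        rw [Equiv.Perm.mul_apply, hc i hi s hs, hgc i hi s hs]

/-- A permutation that carries one dyadic subdivision to another in an order preserving way
belongs to `F`. -/
lemma mem_ThompsonF_of_carriesAffinely {N : ℕ} {a b : ℕ → ℝ} {k : Equiv.Perm ℝ}
    (ha : IsDyadicSubdivision N a) (hb : IsDyadicSubdivision N b)
    (hk : ∀ t ∉ Ico (0:ℝ) 1, k t = t) (hab : CarriesAffinely N a b k) : k ∈ ThompsonF := by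
  obtain ⟨g, hg, hga⟩ := exists_carriesAffinely_rightVine N a ha
  obtain ⟨h, hh, hhb⟩ := exists_carriesAffinely_rightVine N b hb
  suffices k = h⁻¹ * g from this ▸ mul_mem (inv_mem hh) hg
  rw [eq_inv_mul_iff_mul_eq]
  ext t
  rw [Equiv.Perm.mul_apply]
  by_cases ht : t ∈ Ico (0:ℝ) 1
  · obtain ⟨i, hi, hti⟩ := ha.exists_mem_Ico ht
    have hlt : 0 < a (i + 1) - a i := sub_pos.2 (ha.pair i hi).lt
    obtain ⟨s, hs, rfl⟩ : ∃ s ∈ Ico (0:ℝ) 1, t = a i + s * (a (i + 1) - a i) := by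
      refine ⟨(t - a i) / (a (i + 1) - a i), ⟨div_nonneg (by linarith [hti.1]) hlt.le, ?_⟩, ?_⟩
      · rw [div_lt_one hlt]; linarith [hti.2]
      · field_simp; ring
    rw [hab i hi s hs, hga i hi s hs, hhb i hi s hs]
  · rw [hk t ht, ThompsonF.apply_eq_self hh t ht, ThompsonF.apply_eq_self hg t ht]

end Generators

section Centralizer

/-- A strictly increasing map fixes every point of a finite set that it preserves. -/
lemma StrictMono.map_eq_self_of_mapsTo_finite {f : ℝ → ℝ} (hf : StrictMono f) {D : Set ℝ}
    (hD : D.Finite) (hmap : MapsTo f D D) {p : ℝ} (hp : p ∈ D) : f p = p := by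
  have := hD.to_subtype
  have hinj : Function.Injective (hmap.restrict f D D) := hmap.restrict_inj.2 hf.injective.injOn
  obtain ⟨n, hn, hper⟩ := Function.mem_periodicPts.1 (hinj.mem_periodicPts ⟨p, hp⟩)
  have hit : f^[n] p = p := by
    have := congrArg Subtype.val hper.eq
    rwa [hmap.iterate_restrict] at this
  have := (Function.Commute.id_right (f := f)).iterate_pos_eq_iff_map_eq hf.monotone strictMono_id
    (x := p) hn
  simpa [hit] using this

/-- A permutation commuting with a homeomorphism has an invariant set of discontinuities. -/
lemma not_continuousAt_apply_of_commute {f k : Equiv.Perm ℝ} (hf : Continuous f)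
    (hf' : Continuous ⇑f⁻¹) (hc : k * f = f * k) {p : ℝ} (hp : ¬ ContinuousAt k p) :
    ¬ ContinuousAt k (f p) := by
  intro h
  apply hp
  have hk : (k : ℝ → ℝ) = ⇑f⁻¹ ∘ k ∘ f := by
    have : k = f⁻¹ * (k * f) := by rw [hc]; group
    exact congrArg DFunLike.coe this
  rw [hk]
  exact hf'.continuousAt.comp (h.comp hf.continuousAt)

end Centralizer

theorem centralizer_in_V_equals_centralizer_in_F (f : Equiv.Perm ℝ) (hf : f ∈ ThompsonF)
    (hfix : ∀ q ∈ Set.Ioo (0:ℝ) 1, IsDyadicRat q → f q ≠ q) :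
    ∀ k : Equiv.Perm ℝ, MemV k → k * f = f * k →
      StrictMonoOn k (Set.Ico (0:ℝ) 1) ∧ k ∈ ThompsonF := by
  rintro k ⟨hid, N, a, b, σ, ha0, haN, hb0, hbN, hamono, hbmono, hpiece⟩ hcomm
  have ext_pair : ∀ c : Fin (N + 1) → ℝ, c 0 = 0 → c (Fin.last N) = 1 →
      (∀ i : Fin N, IsStdDyadicPair (c i.castSucc) (c i.succ)) →
      IsDyadicSubdivision N (fun i => if h : i < N + 1 then c ⟨i, h⟩ else 0) := by
    intro c h0 h1 h
    refine ⟨by simpa using h0, by simpa [Fin.last] using h1, fun i hi => ?_⟩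
    simp only [show i < N + 1 by omega, show i + 1 < N + 1 by omega, dite_true]
    exact h ⟨i, hi⟩
  have hA := ext_pair a ha0 haN fun i => (hpiece i).1
  have hB := ext_pair b hb0 hbN fun i => (hpiece i).2.1
  have locate : ∀ t ∈ Ico (0:ℝ) 1, ∃ i : Fin N, t ∈ Ico (a i.castSucc) (a i.succ) := by
    intro t ht
    obtain ⟨i, hi, hti⟩ := hA.exists_mem_Ico ht
    simp only [show i < N + 1 by omega, show i + 1 < N + 1 by omega, dite_true] at hti
    exact ⟨⟨i, hi⟩, hti⟩
  have hNpos : 0 < N := hA.pos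
  -- the discontinuities of `k` are breakpoints
  have hdisc : {p | ¬ ContinuousAt k p} ⊆ range a := by
    intro p hp
    by_contra hpa
    apply hp
    have hne : ∀ i, p ≠ a i := fun i h => hpa ⟨i, h.symm⟩
    rcases lt_trichotomy p 0 with h | h | h
    · refine continuousAt_id.congr ?_
      filter_upwards [Iio_mem_nhds h] with t ht
      exact (hid t fun h' => absurd h'.1 (not_le.2 ht)).symm
    · exact absurd (h.trans ha0.symm) (hne 0)
    · rcases lt_trichotomy p 1 with h1 | h1 | h1
      · obtain ⟨i, hi⟩ := locate p ⟨h.le, h1⟩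
        obtain ⟨-, -, c, d, -, hcd, -⟩ := hpiece i
        have hlin : ContinuousAt (fun t : ℝ => c * t + d) p := by fun_prop
        refine hlin.congr ?_
        filter_upwards [Ioo_mem_nhds (lt_of_le_of_ne hi.1 (hne _).symm) hi.2] with t ht
        exact (hcd t ⟨ht.1.le, ht.2⟩).symm
      · exact absurd (h1.trans haN.symm) (hne _)
      · refine continuousAt_id.congr ?_
        filter_upwards [Ioi_mem_nhds h1] with t ht
        exact (hid t fun h' => absurd h'.2 (not_lt.2 (le_of_lt ht))).symm
  have hcontAt : ∀ p ∈ Ioo (0:ℝ) 1, ContinuousAt k p := by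
    intro p hp
    by_contra hpc
    have hfp := (ThompsonF.strictMono hf).map_eq_self_of_mapsTo_finite
      ((finite_range a).subset hdisc)
      (fun q hq => not_continuousAt_apply_of_commute (ThompsonF.continuous hf)
        (ThompsonF.continuous (inv_mem hf)) hcomm hq) hpc
    obtain ⟨i, rfl⟩ := hdisc hpc
    have hi : i ≠ Fin.last N := by rintro rfl; exact absurd hp.2 (by simp [haN])
    obtain ⟨j, rfl⟩ := Fin.exists_castSucc_eq.2 hi
    exact hfix _ hp (hpiece j).1.isDyadicRat hfp
  let i₀ : Fin N := ⟨0, hNpos⟩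
  have hi₀ : a i₀.castSucc = 0 := ha0
  obtain ⟨-, -, c, d, hc, hcd, -⟩ := hpiece i₀
  rw [hi₀] at hcd
  have ha1 : 0 < a i₀.succ := by rw [← hi₀]; exact hamono Fin.castSucc_lt_succ
  have hcont : ContinuousOn k (Ico 0 1) := by
    intro p hp
    rcases hp.1.eq_or_lt with rfl | h
    · have hlin : ContinuousAt (fun t : ℝ => c * t + d) 0 := by fun_prop
      refine hlin.continuousWithinAt.congr_of_eventuallyEq ?_ (hcd 0 ⟨le_rfl, ha1⟩)
      filter_upwards [self_mem_nhdsWithin, mem_nhdsWithin_of_mem_nhds (Iio_mem_nhds ha1)]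
        with t ht ht'
      exact hcd t ⟨ht.1, ht'⟩
    · exact (hcontAt p ⟨h, hp.2⟩).continuousWithinAt
  have hmono : StrictMonoOn k (Ico (0:ℝ) 1) := by
    intro x hx y hy hxy
    have hy0 : 0 < y := hx.1.trans_lt hxy
    have hsub : Icc 0 y ⊆ Ico (0:ℝ) 1 := fun t ht => ⟨ht.1, ht.2.trans_lt hy.2⟩
    rcases (hcont.mono hsub).strictMonoOn_of_injOn_Icc' hy0.le k.injective.injOn with h | h
    · exact h ⟨hx.1, hxy.le⟩ ⟨hy0.le, le_rfl⟩ hxy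
    · obtain ⟨t, ht0, ht⟩ := exists_between (lt_min hy0 ha1)
      have := h ⟨le_rfl, hy0.le⟩ ⟨ht0.le, (ht.trans_le (min_le_left _ _)).le⟩ ht0
      rw [hcd 0 ⟨le_rfl, ha1⟩, hcd t ⟨ht0.le, ht.trans_le (min_le_right _ _)⟩] at this
      nlinarith
  have hleft : ∀ i : Fin N, k (a i.castSucc) = b (σ i).castSucc := by
    intro i
    obtain ⟨-, -, c, d, -, hcd, h, -⟩ := hpiece i
    rw [hcd _ ⟨le_rfl, hamono Fin.castSucc_lt_succ⟩, h]
  have hσ : StrictMono σ := by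
    intro i j hij
    have hmem : ∀ i : Fin N, a i.castSucc ∈ Ico (0:ℝ) 1 := fun i =>
      ⟨(hpiece i).1.nonneg, haN ▸ hamono (Fin.castSucc_lt_last i)⟩
    have := hmono (hmem i) (hmem j) (hamono (Fin.castSucc_lt_castSucc_iff.2 hij))
    rw [hleft, hleft] at this
    exact Fin.castSucc_lt_castSucc_iff.1 (hbmono.lt_iff_lt.1 this)
  have hσ1 : ∀ i, σ i = i := fun i => by
    have : hσ.orderIsoOfSurjective σ σ.surjective = OrderIso.refl _ := Subsingleton.elim _ _
    exact congrArg (fun e : Fin N ≃o Fin N => e i) this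
  refine ⟨hmono, mem_ThompsonF_of_carriesAffinely hA hB hid fun i hi s hs => ?_⟩
  simp only [show i < N + 1 by omega, show i + 1 < N + 1 by omega, dite_true]
  obtain ⟨hp, -, c, d, -, hcd, hl, hr⟩ := hpiece ⟨i, hi⟩
  have hlt := hp.lt
  rw [hσ1] at hl hr
  simp only [Fin.castSucc_mk, Fin.succ_mk] at hl hr hcd hlt
  rw [hcd _ ⟨by nlinarith [hs.1], by nlinarith [hs.2]⟩, ← hl, ← hr]
  ring

end
end
end

section
/- For every f in Thompson's group F with c(f) ≥ 4 (equivalently, norm ‖f‖ = 2(c(f)−1) ≥ 6), one has ℓ(f) ≤ 4·c(f) − 12 (equivalently ℓ(f) ≤ 2‖f‖ − 8). -/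
noncomputable section

open Set

noncomputable section

open Set

/-- `breakCount f` is `c(f)`: the least `N ≥ 1` such that there are partitions
`0 = a₀ < ⋯ < a_N = 1` and `0 = b₀ < ⋯ < b_N = 1` of `[0,1]` into standard dyadic
intervals with `f` mapping each `[a_{i−1}, a_i]` affinely (increasingly) onto `[b_{i−1}, b_i]`. -/
def breakCount (f : Equiv.Perm ℝ) : ℕ :=
  sInf {N | 1 ≤ N ∧ ∃ a b : Fin (N + 1) → ℝ,
    a 0 = 0 ∧ a (Fin.last N) = 1 ∧ b 0 = 0 ∧ b (Fin.last N) = 1 ∧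
    StrictMono a ∧ StrictMono b ∧
    ∀ i : Fin N, IsStdDyadicPair (a i.castSucc) (a i.succ) ∧
      IsStdDyadicPair (b i.castSucc) (b i.succ) ∧
      ∃ c d : ℝ, 0 < c ∧ (∀ t ∈ Set.Icc (a i.castSucc) (a i.succ), f t = c * t + d) ∧
        c * a i.castSucc + d = b i.castSucc ∧ c * a i.succ + d = b i.succ}


/-! ### Words in the generators -/

/-- `f` is a product of at most `n` generators or inverses of generators. -/
def IsShortWord (n : ℕ) (f : Equiv.Perm ℝ) : Prop :=
  ∃ w : List (Equiv.Perm ℝ), w.length ≤ n ∧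
    (∀ g ∈ w, g ∈ ({x0, x1, x0⁻¹, x1⁻¹} : Set (Equiv.Perm ℝ))) ∧ w.prod = f

lemma IsShortWord.one (n : ℕ) : IsShortWord n 1 := ⟨[], by simp⟩

lemma IsShortWord.of_mem {g : Equiv.Perm ℝ}
    (hg : g ∈ ({x0, x1, x0⁻¹, x1⁻¹} : Set (Equiv.Perm ℝ))) : IsShortWord 1 g :=
  ⟨[g], by simp, by simpa using hg, by simp⟩

lemma IsShortWord.mul {m n : ℕ} {f g : Equiv.Perm ℝ} (hf : IsShortWord m f)
    (hg : IsShortWord n g) : IsShortWord (m + n) (f * g) := by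
  obtain ⟨v, hv, hv', rfl⟩ := hf
  obtain ⟨w, hw, hw', rfl⟩ := hg
  refine ⟨v ++ w, by simp; omega, ?_, by simp⟩
  intro g hg
  rcases List.mem_append.1 hg with h | h
  exacts [hv' g h, hw' g h]

lemma IsShortWord.inv {n : ℕ} {f : Equiv.Perm ℝ} (hf : IsShortWord n f) :
    IsShortWord n f⁻¹ := by
  obtain ⟨w, hw, hw', rfl⟩ := hf
  refine ⟨(w.map (·⁻¹)).reverse, by simpa using hw, ?_, (List.prod_inv_reverse w).symm⟩
  intro g hg
  obtain ⟨h, hh, rfl⟩ := List.mem_map.1 (List.mem_reverse.1 hg)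
  rcases hw' h hh with rfl | rfl | rfl | rfl <;> simp

lemma IsShortWord.wordLength_le {n : ℕ} {f : Equiv.Perm ℝ} (hf : IsShortWord n f) :
    wordLength f ≤ n := by
  obtain ⟨w, hw, hw', hp⟩ := hf
  have hle : wordLength f ≤ w.length := Nat.sInf_le ⟨w, rfl, hw', hp⟩
  exact hle.trans hw

lemma IsShortWord.mem_thompsonF {n : ℕ} {f : Equiv.Perm ℝ} (hf : IsShortWord n f) :
    f ∈ ThompsonF := by
  obtain ⟨w, -, hw', rfl⟩ := hf
  refine Subgroup.list_prod_mem _ fun g hg => ?_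
  have h0 : x0 ∈ ThompsonF := Subgroup.subset_closure (by simp)
  have h1 : x1 ∈ ThompsonF := Subgroup.subset_closure (by simp)
  rcases hw' g hg with rfl | rfl | rfl | rfl
  exacts [h0, h1, inv_mem h0, inv_mem h1]

lemma thompsonF_apply_of_notMem_Icc {f : Equiv.Perm ℝ} (hf : f ∈ ThompsonF) {t : ℝ}
    (ht : t ∉ Set.Icc (0 : ℝ) 1) : f t = t := by
  suffices h : ThompsonF ≤ MulAction.stabilizer (Equiv.Perm ℝ) t from h hf
  refine (Subgroup.closure_le _).2 ?_
  have ht' : t < 0 ∨ 1 < t := by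
    by_contra! h
    exact ht h
  rintro g (rfl | rfl)
  · change x0fun t = t
    unfold x0fun
    split_ifs <;> rcases ht' with h | h <;> linarith
  · change x1fun t = t
    unfold x1fun
    split_ifs <;> rcases ht' with h | h <;> linarith

/-! ### Piecewise affine maps between lists of intervals -/

/-- `f` maps the interval with endpoints `p` affinely onto the interval with endpoints `q`. -/
def MapsAffinely (f : ℝ → ℝ) (p q : ℝ × ℝ) : Prop :=
  ∀ s ∈ Set.Icc (0 : ℝ) 1, f ((1 - s) * p.1 + s * p.2) = (1 - s) * q.1 + s * q.2

lemma MapsAffinely.left {f : ℝ → ℝ} {a b c d : ℝ} (h : MapsAffinely f (a, b) (c, d)) :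
    MapsAffinely f (a, (a + b) / 2) (c, (c + d) / 2) := by
  intro s hs
  have := h (s / 2) ⟨by linarith [hs.1], by linarith [hs.2]⟩
  refine (congrArg f ?_).trans (this.trans ?_) <;> ring

lemma MapsAffinely.right {f : ℝ → ℝ} {a b c d : ℝ} (h : MapsAffinely f (a, b) (c, d)) :
    MapsAffinely f ((a + b) / 2, b) ((c + d) / 2, d) := by
  intro s hs
  have := h ((1 + s) / 2) ⟨by linarith [hs.1], by linarith [hs.2]⟩
  refine (congrArg f ?_).trans (this.trans ?_) <;> ring

lemma forall₂_mapsAffinely_mul {f g : Equiv.Perm ℝ} {k l m : List (ℝ × ℝ)}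
    (hf : List.Forall₂ (MapsAffinely f) k l) (hg : List.Forall₂ (MapsAffinely g) l m) :
    List.Forall₂ (MapsAffinely ⇑(g * f)) k m := by
  induction hf generalizing m with
  | nil => cases hg; exact .nil
  | cons h _ ih =>
    cases hg with
    | cons h' hg =>
      refine .cons (fun s hs => ?_) (ih hg)
      rw [Equiv.Perm.mul_apply, h s hs, h' s hs]

lemma forall₂_mapsAffinely_inv {f : Equiv.Perm ℝ} {k l : List (ℝ × ℝ)}
    (hf : List.Forall₂ (MapsAffinely f) k l) : List.Forall₂ (MapsAffinely ⇑f⁻¹) l k := by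
  induction hf with
  | nil => exact .nil
  | cons h _ ih =>
    refine .cons (fun s hs => ?_) ih
    rw [← h s hs]
    exact f.symm_apply_apply _

lemma eq_of_forall₂_mapsAffinely {f g : ℝ → ℝ} {k l : List (ℝ × ℝ)}
    (hf : List.Forall₂ (MapsAffinely f) k l) (hg : List.Forall₂ (MapsAffinely g) k l)
    {p : ℝ × ℝ} (hp : p ∈ k) {s : ℝ} (hs : s ∈ Set.Icc (0 : ℝ) 1) :
    f ((1 - s) * p.1 + s * p.2) = g ((1 - s) * p.1 + s * p.2) := by
  induction hf with
  | nil => simp at hp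
  | cons h _ ih =>
    cases hg with
    | cons h' hg =>
      rcases List.mem_cons.1 hp with rfl | hp
      · rw [h s hs, h' s hs]
      · exact ih hg hp

/-! ### Binary trees -/

/-- Finite rooted binary trees, encoding dyadic subdivisions of an interval. -/
inductive DyadicTree
  | leaf : DyadicTree
  | node : DyadicTree → DyadicTree → DyadicTree

namespace DyadicTree

/-- The intervals, from left to right, of the subdivision of `[a, b]` given by a tree. -/
def pieces : DyadicTree → ℝ → ℝ → List (ℝ × ℝ)
  | leaf, a, b => [(a, b)]
  | node l r, a, b => l.pieces a ((a + b) / 2) ++ r.pieces ((a + b) / 2) b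

/-- The number of leaves of a tree. -/
def numLeaves : DyadicTree → ℕ
  | leaf => 1
  | node l r => l.numLeaves + r.numLeaves

/-- The number of nodes on the right spine of a tree. -/
def spine : DyadicTree → ℕ
  | leaf => 0
  | node _ r => r.spine + 1

lemma numLeaves_pos (T : DyadicTree) : 0 < T.numLeaves := by
  induction T with
  | leaf => simp [numLeaves]
  | node l r hl hr => simp [numLeaves, hl]

lemma spine_lt_numLeaves (T : DyadicTree) : T.spine < T.numLeaves := by
  induction T with
  | leaf => simp [numLeaves, spine]
  | node l r hl hr =>
    have := l.numLeaves_pos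
    simp only [numLeaves, spine]
    omega

lemma length_pieces (T : DyadicTree) (a b : ℝ) : (T.pieces a b).length = T.numLeaves := by
  induction T generalizing a b with
  | leaf => rfl
  | node l r hl hr => simp [pieces, numLeaves, hl, hr]

lemma exists_mem_pieces (T : DyadicTree) {a b t : ℝ} (ht : t ∈ Set.Icc a b) :
    ∃ p ∈ T.pieces a b, ∃ s ∈ Set.Icc (0 : ℝ) 1, t = (1 - s) * p.1 + s * p.2 := by
  induction T generalizing a b with
  | leaf =>
    refine ⟨(a, b), by simp [pieces], ?_⟩
    obtain ⟨x, y, hx, hy, hxy, rfl⟩ :=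
      (Convex.mem_Icc (ht.1.trans ht.2)).1 ht
    exact ⟨y, ⟨hy, by linarith⟩, by rw [← hxy]; ring⟩
  | node l r hl hr =>
    rcases le_total t ((a + b) / 2) with h | h
    · obtain ⟨p, hp, hs⟩ := hl ⟨ht.1, h⟩
      exact ⟨p, List.mem_append_left _ hp, hs⟩
    · obtain ⟨p, hp, hs⟩ := hr ⟨h, ht.2⟩
      exact ⟨p, List.mem_append_right _ hp, hs⟩

lemma forall₂_pieces {f : ℝ → ℝ} {a b c d : ℝ} (T : DyadicTree)
    (h : MapsAffinely f (a, b) (c, d)) :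
    List.Forall₂ (MapsAffinely f) (T.pieces a b) (T.pieces c d) := by
  induction T generalizing a b c d with
  | leaf => exact .cons h .nil
  | node l r hl hr => exact List.rel_append (hl h.left) (hr h.right)

/-- `f` maps the subdivision of `[0, 1]` given by `T` piecewise affinely to that given by `S`. -/
def Carries (f : Equiv.Perm ℝ) (T S : DyadicTree) : Prop :=
  List.Forall₂ (MapsAffinely f) (T.pieces 0 1) (S.pieces 0 1)

lemma Carries.mul {f g : Equiv.Perm ℝ} {T S U : DyadicTree} (hg : Carries g S U)
    (hf : Carries f T S) : Carries (g * f) T U :=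
  forall₂_mapsAffinely_mul hf hg

lemma Carries.inv {f : Equiv.Perm ℝ} {T S : DyadicTree} (hf : Carries f T S) :
    Carries f⁻¹ S T :=
  forall₂_mapsAffinely_inv hf

lemma Carries.eq_on_Icc {f g : Equiv.Perm ℝ} {T S : DyadicTree} (hf : Carries f T S)
    (hg : Carries g T S) {t : ℝ} (ht : t ∈ Set.Icc (0 : ℝ) 1) : f t = g t := by
  obtain ⟨p, hp, s, hs, rfl⟩ := T.exists_mem_pieces ht
  exact eq_of_forall₂_mapsAffinely hf hg hp hs

lemma carries_one (T : DyadicTree) : Carries 1 T T :=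
  T.forall₂_pieces fun _ _ => rfl

lemma carries_x0 (l m r : DyadicTree) :
    Carries x0 (node l (node m r)) (node (node l m) r) := by
  simp only [Carries, pieces, List.append_assoc]
  refine List.rel_append (l.forall₂_pieces ?_)
    (List.rel_append (m.forall₂_pieces ?_) (r.forall₂_pieces ?_)) <;>
  · rintro s ⟨h0, h1⟩
    change x0fun _ = _
    dsimp only
    unfold x0fun
    split_ifs <;> linarith

lemma carries_x1 (k l m r : DyadicTree) :
    Carries x1 (node k (node l (node m r))) (node k (node (node l m) r)) := by
  simp only [Carries, pieces, List.append_assoc]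
  refine List.rel_append (k.forall₂_pieces ?_) (List.rel_append (l.forall₂_pieces ?_)
    (List.rel_append (m.forall₂_pieces ?_) (r.forall₂_pieces ?_))) <;>
  · rintro s ⟨h0, h1⟩
    change x1fun _ = _
    dsimp only
    unfold x1fun
    split_ifs <;> linarith

/-! ### Rotating a tree to a standard one -/

/-- The left comb grown from `L` by `k` leaves, completed by a right comb with three leaves. -/
def target : DyadicTree → ℕ → DyadicTree
  | L, 0 => node L (node leaf (node leaf leaf))
  | L, k + 1 => target (node L leaf) k

lemma eq_leaf_of_numLeaves {T : DyadicTree} (h : T.numLeaves = 1) : T = leaf := by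
  cases T with
  | leaf => rfl
  | node l r =>
    have := l.numLeaves_pos
    have := r.numLeaves_pos
    simp only [numLeaves] at h
    omega

lemma exists_carries_target (R : DyadicTree) (L : DyadicTree) (k n : ℕ)
    (hk : R.numLeaves = k + 3) (hn : n + R.spine + 4 = 2 * R.numLeaves) :
    ∃ g, IsShortWord n g ∧ Carries g (node L R) (target L k) := by
  induction n generalizing R L k with
  | zero =>
    have := R.spine_lt_numLeaves
    obtain rfl : k = 0 := by omega
    cases R with
    | leaf => simp [numLeaves] at hk
    | node l r =>
      have := l.numLeaves_pos
      have := r.spine_lt_numLeaves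
      simp only [numLeaves, spine] at *
      obtain rfl : l = leaf := eq_leaf_of_numLeaves (by omega)
      cases r with
      | leaf => simp [numLeaves] at hk
      | node u v =>
        have := u.numLeaves_pos
        have := v.numLeaves_pos
        simp only [numLeaves, spine] at *
        obtain rfl : u = leaf := eq_leaf_of_numLeaves (by omega)
        obtain rfl : v = leaf := eq_leaf_of_numLeaves (by omega)
        exact ⟨1, .one 0, carries_one _⟩
  | succ n ih =>
    cases R with
    | leaf => simp [numLeaves] at hk
    | node l r =>
      cases l with
      | leaf =>
        simp only [numLeaves, spine] at hk hn
        cases k with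
        | zero =>
          cases r with
          | leaf => simp [numLeaves] at hk
          | node u v =>
            have := u.numLeaves_pos
            have := v.numLeaves_pos
            simp only [numLeaves] at hk
            obtain rfl : u = leaf := eq_leaf_of_numLeaves (by omega)
            obtain rfl : v = leaf := eq_leaf_of_numLeaves (by omega)
            exact ⟨1, .one _, carries_one _⟩
        | succ k =>
          obtain ⟨g, hg, hg'⟩ := ih r (node L leaf) k (by omega) (by omega)
          exact ⟨g * x0, hg.mul (.of_mem (by simp)), hg'.mul (carries_x0 L leaf r)⟩
      | node u v =>
        simp only [numLeaves, spine] at hk hn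
        obtain ⟨g, hg, hg'⟩ := ih (node u (node v r)) L k
          (by simp only [numLeaves]; omega) (by simp only [numLeaves, spine]; omega)
        exact ⟨g * x1⁻¹, hg.mul (.of_mem (by simp)), hg'.mul (carries_x1 L u v r).inv⟩

lemma exists_carries_target_leaf (T : DyadicTree) (k n : ℕ)
    (hk : T.numLeaves = k + 4) (hn : n + T.spine + 5 = 2 * T.numLeaves) :
    ∃ g, IsShortWord n g ∧ Carries g T (target leaf k) := by
  cases T with
  | leaf => simp [numLeaves] at hk
  | node l r =>
    induction l generalizing r n with
    | leaf =>
      simp only [numLeaves, spine] at hk hn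
      exact exists_carries_target r leaf k n (by omega) (by omega)
    | node u v ih _ =>
      have := u.numLeaves_pos
      have := v.numLeaves_pos
      have := r.spine_lt_numLeaves
      simp only [numLeaves, spine] at hk hn
      obtain ⟨n, rfl⟩ := Nat.exists_eq_add_of_le' (show 1 ≤ n by omega)
      obtain ⟨g, hg, hg'⟩ := ih n (node v r)
        (by simp only [numLeaves]; omega) (by simp only [numLeaves, spine]; omega)
      exact ⟨g * x0⁻¹, hg.mul (.of_mem (by simp)), hg'.mul (carries_x0 u v r).inv⟩

lemma exists_carries_target_of_numLeaves (T : DyadicTree) (k : ℕ) (hk : T.numLeaves = k + 4) :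
    ∃ g, IsShortWord (2 * k + 2) g ∧ Carries g T (target leaf k) := by
  have hlt := T.spine_lt_numLeaves
  have hpos : 0 < T.spine := by
    cases T with
    | leaf => simp [numLeaves] at hk
    | node l r => simp [spine]
  obtain ⟨g, ⟨w, hw, hw'⟩, hg⟩ :=
    T.exists_carries_target_leaf k (2 * k + 3 - T.spine) hk (by omega)
  exact ⟨g, ⟨w, by omega, hw'⟩, hg⟩

end DyadicTree

/-! ### Dyadic partitions come from trees -/

/-- `l` lists consecutive nondegenerate standard dyadic intervals running from `p` to `q`. -/
def IsDyadicPath : ℝ → ℝ → List (ℝ × ℝ) → Prop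
  | p, q, [] => p = q
  | p, q, x :: l => x.1 = p ∧ x.1 < x.2 ∧ IsStdDyadicPair x.1 x.2 ∧ IsDyadicPath x.2 q l

namespace IsDyadicPath

lemma le {p q : ℝ} {l : List (ℝ × ℝ)} (h : IsDyadicPath p q l) : p ≤ q := by
  induction l generalizing p with
  | nil => exact le_of_eq h
  | cons x l ih =>
    obtain ⟨rfl, hx, -, hl⟩ := h
    exact hx.le.trans (ih hl)

lemma eq_nil {p : ℝ} {l : List (ℝ × ℝ)} (h : IsDyadicPath p p l) : l = [] := by
  cases l with
  | nil => rfl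
  | cons x l =>
    obtain ⟨rfl, hx, -, hl⟩ := h
    exact absurd hl.le (not_le.2 hx)

/-- A path either breaks at a given intermediate point or has a piece around that point. -/
lemma split {p q x : ℝ} {l : List (ℝ × ℝ)} (h : IsDyadicPath p q l) (hp : p ≤ x) (hq : x ≤ q) :
    (∃ l₁ l₂, l = l₁ ++ l₂ ∧ IsDyadicPath p x l₁ ∧ IsDyadicPath x q l₂) ∨
      ∃ l₁ y l₂, l = l₁ ++ y :: l₂ ∧ IsDyadicPath p y.1 l₁ ∧ IsDyadicPath y.2 q l₂ ∧
        IsStdDyadicPair y.1 y.2 ∧ y.1 < x ∧ x < y.2 := by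
  induction l generalizing p with
  | nil =>
    obtain rfl : p = q := h
    exact .inl ⟨[], [], rfl, le_antisymm hp hq, le_antisymm hq hp⟩
  | cons y l ih =>
    obtain ⟨rfl, hy, hd, hl⟩ := h
    rcases le_or_gt y.2 x with hx | hx
    · rcases ih hl hx with ⟨l₁, l₂, rfl, h₁, h₂⟩ | ⟨l₁, z, l₂, rfl, h₁, h₂⟩
      · exact .inl ⟨y :: l₁, l₂, rfl, ⟨rfl, hy, hd, h₁⟩, h₂⟩
      · exact .inr ⟨y :: l₁, z, l₂, rfl, ⟨rfl, hy, hd, h₁⟩, h₂⟩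
    · rcases hp.eq_or_lt with rfl | hp
      · exact .inl ⟨[], y :: l, rfl, rfl, rfl, hy, hd, hl⟩
      · exact .inr ⟨[], y, l, rfl, rfl, hl, hd, hp, hx⟩

end IsDyadicPath

/-- A standard dyadic interval containing the midpoint of another one in its interior
contains the whole of it. -/
lemma IsStdDyadicPair.le_of_midpoint {a b c d : ℝ} (h : IsStdDyadicPair a b)
    (h' : IsStdDyadicPair c d) (hc : c < (a + b) / 2) (hd : (a + b) / 2 < d) :
    c ≤ a ∧ b ≤ d := by
  obtain ⟨k, m, rfl, rfl⟩ := h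
  obtain ⟨j, n, rfl, rfl⟩ := h'
  have hmid : ((k : ℝ) / 2 ^ m + ((k : ℝ) + 1) / 2 ^ m) / 2 = (2 * k + 1) / (2 * 2 ^ m) := by
    field_simp
    ring
  rw [hmid] at hc hd
  rw [div_lt_div_iff₀ (by positivity) (by positivity)] at hc hd
  have hc' : j * (2 * 2 ^ m) < (2 * k + 1) * 2 ^ n := by exact_mod_cast hc
  have hd' : (2 * k + 1) * 2 ^ n < (j + 1) * (2 * 2 ^ m) := by exact_mod_cast hd
  have hnm : n ≤ m := by
    by_contra! hlt
    obtain ⟨e, rfl⟩ := Nat.exists_eq_add_of_lt hlt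
    have hpow : 2 ^ (m + e + 1) = 2 ^ e * (2 * 2 ^ m) := by ring
    rw [hpow, ← mul_assoc (2 * k + 1)] at hc' hd'
    have h₁ := lt_of_mul_lt_mul_right hc' (Nat.zero_le _)
    have h₂ := lt_of_mul_lt_mul_right hd' (Nat.zero_le _)
    omega
  obtain ⟨e, rfl⟩ := Nat.exists_eq_add_of_le hnm
  have h₁ : j * 2 ^ e ≤ k := by
    have : (2 * (j * 2 ^ e)) * 2 ^ n < (2 * k + 1) * 2 ^ n := by
      calc _ = j * (2 * 2 ^ (n + e)) := by ring
        _ < _ := hc'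
    have := lt_of_mul_lt_mul_right this (Nat.zero_le _)
    omega
  have h₂ : k + 1 ≤ (j + 1) * 2 ^ e := by
    have : (2 * k + 1) * 2 ^ n < (2 * ((j + 1) * 2 ^ e)) * 2 ^ n := by
      calc _ < (j + 1) * (2 * 2 ^ (n + e)) := hd'
        _ = _ := by ring
    have := lt_of_mul_lt_mul_right this (Nat.zero_le _)
    omega
  have h₁' : (j : ℝ) * 2 ^ e ≤ k := by exact_mod_cast h₁
  have h₂' : (k : ℝ) + 1 ≤ (j + 1) * 2 ^ e := by exact_mod_cast h₂
  constructor
  · rw [div_le_div_iff₀ (by positivity) (by positivity), pow_add]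
    calc (j : ℝ) * (2 ^ n * 2 ^ e) = j * 2 ^ e * 2 ^ n := by ring
      _ ≤ k * 2 ^ n := by gcongr
  · rw [div_le_div_iff₀ (by positivity) (by positivity), pow_add]
    calc ((k : ℝ) + 1) * 2 ^ n ≤ (j + 1) * 2 ^ e * 2 ^ n := by gcongr
      _ = _ := by ring

lemma IsStdDyadicPair.lt_s9 {a b : ℝ} (h : IsStdDyadicPair a b) : a < b := by
  obtain ⟨k, m, rfl, rfl⟩ := h
  gcongr
  linarith

lemma IsStdDyadicPair.left {a b : ℝ} (h : IsStdDyadicPair a b) :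
    IsStdDyadicPair a ((a + b) / 2) := by
  obtain ⟨k, m, rfl, rfl⟩ := h
  refine ⟨2 * k, m + 1, ?_, ?_⟩ <;> push_cast <;> field_simp <;> ring

lemma IsStdDyadicPair.right {a b : ℝ} (h : IsStdDyadicPair a b) :
    IsStdDyadicPair ((a + b) / 2) b := by
  obtain ⟨k, m, rfl, rfl⟩ := h
  refine ⟨2 * k + 1, m + 1, ?_, ?_⟩ <;> push_cast <;> field_simp <;> ring

lemma IsDyadicPath.exists_tree {a b : ℝ} (hab : IsStdDyadicPair a b) {l : List (ℝ × ℝ)}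
    (h : IsDyadicPath a b l) : ∃ T : DyadicTree, T.pieces a b = l := by
  induction hn : l.length using Nat.strong_induction_on generalizing a b l with
  | _ n ih =>
    have hlt := hab.lt_s9
    rcases h.split (x := (a + b) / 2) (by linarith) (by linarith) with
      ⟨l₁, l₂, rfl, h₁, h₂⟩ | ⟨l₁, y, l₂, rfl, h₁, h₂, hy, hy₁, hy₂⟩
    · have hl₁ : l₁ ≠ [] := by
        rintro rfl
        have : a = (a + b) / 2 := h₁
        linarith
      have hl₂ : l₂ ≠ [] := by
        rintro rfl
        have : (a + b) / 2 = b := h₂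
        linarith
      have := List.length_pos_iff.2 hl₁
      have := List.length_pos_iff.2 hl₂
      rw [List.length_append] at hn
      obtain ⟨T₁, rfl⟩ := ih l₁.length (by omega) hab.left h₁ rfl
      obtain ⟨T₂, rfl⟩ := ih l₂.length (by omega) hab.right h₂ rfl
      exact ⟨.node T₁ T₂, rfl⟩
    · obtain ⟨hya, hyb⟩ := hab.le_of_midpoint hy hy₁ hy₂
      obtain ⟨c, d⟩ := y
      obtain rfl : a = c := le_antisymm h₁.le hya
      obtain rfl : d = b := le_antisymm h₂.le hyb
      rw [h₁.eq_nil, h₂.eq_nil]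
      exact ⟨.leaf, rfl⟩

lemma isDyadicPath_ofFn {N : ℕ} (a : Fin (N + 1) → ℝ)
    (h : ∀ i : Fin N, IsStdDyadicPair (a i.castSucc) (a i.succ)) :
    IsDyadicPath (a 0) (a (Fin.last N))
      (List.ofFn fun i : Fin N => (a i.castSucc, a i.succ)) := by
  induction N with
  | zero => exact rfl
  | succ N ih =>
    rw [List.ofFn_succ]
    exact ⟨rfl, (h 0).lt_s9, h 0, ih (fun i => a i.succ) fun i => h i.succ⟩

lemma exists_tree_of_partition {N : ℕ} (a : Fin (N + 1) → ℝ) (ha₀ : a 0 = 0)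
    (ha₁ : a (Fin.last N) = 1) (h : ∀ i : Fin N, IsStdDyadicPair (a i.castSucc) (a i.succ)) :
    ∃ T : DyadicTree, T.numLeaves = N ∧
      T.pieces 0 1 = List.ofFn fun i : Fin N => (a i.castSucc, a i.succ) := by
  have hpath := isDyadicPath_ofFn a h
  rw [ha₀, ha₁] at hpath
  obtain ⟨T, hT⟩ := hpath.exists_tree ⟨0, 0, by simp, by simp⟩
  exact ⟨T, by rw [← T.length_pieces 0 1, hT, List.length_ofFn], hT⟩

/-! ### The length bound -/

theorem length_upper_bound_improved (f : Equiv.Perm ℝ) (hf : f ∈ ThompsonF)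
    (hc : 4 ≤ breakCount f) :
    (wordLength f : ℤ) ≤ 4 * (breakCount f : ℤ) - 12 := by
  have hne : breakCount f ≠ 0 := by omega
  have hmem := Nat.sInf_mem (Nat.nonempty_of_pos_sInf (Nat.pos_of_ne_zero hne))
  change breakCount f ∈ _ at hmem
  generalize breakCount f = N at hc hmem ⊢
  obtain ⟨-, a, b, ha₀, ha₁, hb₀, hb₁, -, -, h⟩ := hmem
  obtain ⟨T, hTN, hT⟩ := exists_tree_of_partition a ha₀ ha₁ fun i => (h i).1
  obtain ⟨S, hSN, hS⟩ := exists_tree_of_partition b hb₀ hb₁ fun i => (h i).2.1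
  have hfTS : DyadicTree.Carries f T S := by
    rw [DyadicTree.Carries, hT, hS, List.forall₂_iff_get]
    refine ⟨by simp, fun i hi hi' => ?_⟩
    simp only [List.get_ofFn]
    intro s hs
    obtain ⟨-, -, c, d, -, hcd, hl, hr⟩ := h ⟨i, by simpa using hi⟩
    have hlt := (h ⟨i, by simpa using hi⟩).1.lt_s9
    have := hcd _ ((convex_Icc _ _) (Set.left_mem_Icc.2 hlt.le) (Set.right_mem_Icc.2 hlt.le)
      (sub_nonneg.2 hs.2) hs.1 (sub_add_cancel 1 s))
    simp only [smul_eq_mul] at this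
    refine this.trans ?_
    change _ = (1 - s) * b (Fin.castSucc ⟨i, _⟩) + s * b (Fin.succ ⟨i, _⟩)
    rw [← hl, ← hr]
    ring
  obtain ⟨k, hk⟩ := Nat.exists_eq_add_of_le' hc
  obtain ⟨g, hg, hgT⟩ := T.exists_carries_target_of_numLeaves k (hTN.trans hk)
  obtain ⟨g', hg', hgS⟩ := S.exists_carries_target_of_numLeaves k (hSN.trans hk)
  have hw := hg'.inv.mul hg
  have heq : f = g'⁻¹ * g := by
    ext t
    by_cases ht : t ∈ Set.Icc (0 : ℝ) 1
    · exact hfTS.eq_on_Icc (hgS.inv.mul hgT) ht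
    · rw [thompsonF_apply_of_notMem_Icc hf ht,
        thompsonF_apply_of_notMem_Icc hw.mem_thompsonF ht]
  have := hw.wordLength_le
  rw [← heq] at this
  omega

end
end
end
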